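/- arXiv:1807.02222 — 3 statements merged into one kernel-verified Lean document; each statement's English description precedes it below -/
import Mathlib

section
/- Let M be a closed parallel-move based digital surface in ℤ³. For i ∈ {3,4,5,6}, let M_i denote the set of points p ∈ M that have exactly i directly adjacent (6-adjacent) points in M. Let χ(M) = V − E + F be the Euler characteristic of M, where V, E, F are respectively the numbers of 0-cells, 1-cells, and 2-cells of M, and define the genus of M by g = 1 − χ(M)/2. Then g = 1 + (|M₅| + 2·|M₆| − |M₃|)/8. -/
open scoped BigOperators

/-- Points of the 3D grid space ℤ³. -/
abbrev Pt : Type := Fin 3 → ℤ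

/-- The unit vector in direction `i`. -/
def unitVec (i : Fin 3) : Pt := fun j => if j = i then 1 else 0

/-- Direct (6-)adjacency: Euclidean distance one. -/
def Adj6 (p q : Pt) : Prop := ∑ i, (p i - q i) ^ 2 = 1

/-- A 1-cell: a pair of directly adjacent grid points (a unit segment). -/
def Is1Cell (e : Finset Pt) : Prop := ∃ p q : Pt, Adj6 p q ∧ e = {p, q}

/-- A 2-cell: a unit lattice square of 4 grid points. -/
def Is2Cell (c : Finset Pt) : Prop :=
  ∃ (p : Pt) (i j : Fin 3), i ≠ j ∧
    c = {p, p + unitVec i, p + unitVec j, p + unitVec i + unitVec j}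

/-- A 3-cell: a unit lattice cube of 8 grid points. -/
def Is3Cell (c : Finset Pt) : Prop :=
  ∃ p : Pt,
    c = {p, p + unitVec 0, p + unitVec 1, p + unitVec 0 + unitVec 1,
         p + unitVec 2, p + unitVec 0 + unitVec 2, p + unitVec 1 + unitVec 2,
         p + unitVec 0 + unitVec 1 + unitVec 2}

/-- `e'` is a parallel-move of the 1-cell `e` within `S`: `e'` is a 1-cell of `S`
obtained by a unit translation of `e` so that `e ∪ e'` is a 2-cell contained in `S`. -/
def ParallelMove (S : Set Pt) (e e' : Finset Pt) : Prop :=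
  Is1Cell e' ∧ Is2Cell (e ∪ e') ∧ (↑(e ∪ e') : Set Pt) ⊆ S

/-- 6-connectedness of a set of grid points. -/
def Conn6 (S : Set Pt) : Prop :=
  ∀ p ∈ S, ∀ q ∈ S, Relation.ReflTransGen (fun a b => a ∈ S ∧ b ∈ S ∧ Adj6 a b) p q

/-- `c` is a 2-cell contained in `S`. -/
def TwoCellIn (S : Set Pt) (c : Finset Pt) : Prop := Is2Cell c ∧ (↑c : Set Pt) ⊆ S

/-- Two 2-cells of `S` are 1-connected in `S` if joined by a chain of 2-cells of `S`
in which consecutive ones share a 1-cell. -/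
def OneConnectedIn (S : Set Pt) (c c' : Finset Pt) : Prop :=
  Relation.ReflTransGen
    (fun a b => TwoCellIn S a ∧ TwoCellIn S b ∧ ∃ e, Is1Cell e ∧ e ⊆ a ∧ e ⊆ b) c c'

/-- Parallel-move based digital surface (Chen–Zhang). -/
def IsDigitalSurface (S : Set Pt) : Prop :=
  Conn6 S ∧
  (∀ p ∈ S, ∃ c, Is2Cell c ∧ p ∈ c ∧ (↑c : Set Pt) ⊆ S) ∧
  (∀ c c', TwoCellIn S c → TwoCellIn S c' → OneConnectedIn S c c') ∧
  (∀ e, Is1Cell e → (↑e : Set Pt) ⊆ S →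
    {e' | ParallelMove S e e'}.ncard = 1 ∨ {e' | ParallelMove S e e'}.ncard = 2) ∧
  (∀ c, Is3Cell c → ¬ (↑c : Set Pt) ⊆ S)

/-- A closed digital surface: every 1-cell of `S` has exactly two parallel-moves. -/
def IsClosedDigitalSurface (S : Set Pt) : Prop :=
  IsDigitalSurface S ∧
  ∀ e, Is1Cell e → (↑e : Set Pt) ⊆ S → {e' | ParallelMove S e e'}.ncard = 2

/-- The number of directly (6-)adjacent points of `p` belonging to `S`. -/
noncomputable def deg6 (S : Set Pt) (p : Pt) : ℕ := {q ∈ S | Adj6 p q}.ncard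

theorem Adj6.symm {p q : Pt} (h : Adj6 p q) : Adj6 q p := by
  unfold Adj6 at *
  rw [← h]
  exact Finset.sum_congr rfl fun i _ => by ring

theorem not_adj6_self (p : Pt) : ¬ Adj6 p p := by simp [Adj6]

theorem Adj6.ne {p q : Pt} (h : Adj6 p q) : p ≠ q := by
  rintro rfl
  exact not_adj6_self p h

theorem adj6_add_unitVec (p : Pt) (i : Fin 3) : Adj6 p (p + unitVec i) := by
  fin_cases i <;> simp [Adj6, unitVec]

theorem not_adj6_add_unitVec_add_unitVec (p : Pt) {i j : Fin 3} (hij : i ≠ j) :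
    ¬ Adj6 p (p + unitVec i + unitVec j) := by
  fin_cases i <;> fin_cases j <;> simp [Adj6, Fin.sum_univ_three, unitVec] at hij ⊢

theorem not_adj6_unitVec_unitVec (p : Pt) {i j : Fin 3} (hij : i ≠ j) :
    ¬ Adj6 (p + unitVec i) (p + unitVec j) := by
  fin_cases i <;> fin_cases j <;> simp [Adj6, Fin.sum_univ_three, unitVec] at hij ⊢

theorem unitVec_injective : Function.Injective unitVec := fun i j h => by
  simpa [unitVec] using congrFun h i

theorem unitVec_add_unitVec_ne_zero (i j : Fin 3) : unitVec i + unitVec j ≠ 0 := fun h => by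
  have := congrFun h i
  simp only [unitVec, Pi.add_apply, Pi.zero_apply, if_true] at this
  split_ifs at this <;> omega

theorem Adj6.exists_unitVec {p q : Pt} (h : Adj6 p q) :
    ∃ i, q = p + unitVec i ∨ q = p - unitVec i := by
  simp only [Adj6, Fin.sum_univ_three] at h
  have key : ∀ x y z : ℤ, x ^ 2 + y ^ 2 + z ^ 2 = 1 → x = -1 ∨ x = 0 ∨ x = 1 := by
    intro x y z hx
    have h1 : x ≤ 1 := by nlinarith [sq_nonneg y, sq_nonneg z]
    have h2 : -1 ≤ x := by nlinarith [sq_nonneg y, sq_nonneg z]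
    omega
  have h0 := key _ _ _ h
  have h1 := key (p 1 - q 1) (p 0 - q 0) (p 2 - q 2) (by linarith)
  have h2 := key (p 2 - q 2) (p 0 - q 0) (p 1 - q 1) (by linarith)
  have hq : ∀ v : Pt, p 0 - q 0 = - v 0 → p 1 - q 1 = - v 1 → p 2 - q 2 = - v 2 →
      q = p + v := fun v e0 e1 e2 => by
    funext k
    fin_cases k <;> simp <;> omega
  simp only [sub_eq_add_neg p]
  rcases h0 with h0 | h0 | h0 <;> rcases h1 with h1 | h1 | h1 <;>
    rcases h2 with h2 | h2 | h2 <;> rw [h0, h1, h2] at h <;> simp at h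
  · exact ⟨0, Or.inl (hq _ (by simp [h0, unitVec]) (by simp [h1, unitVec])
      (by simp [h2, unitVec]))⟩
  · exact ⟨1, Or.inl (hq _ (by simp [h0, unitVec]) (by simp [h1, unitVec])
      (by simp [h2, unitVec]))⟩
  · exact ⟨2, Or.inl (hq _ (by simp [h0, unitVec]) (by simp [h1, unitVec])
      (by simp [h2, unitVec]))⟩
  · exact ⟨2, Or.inr (hq _ (by simp [h0, unitVec]) (by simp [h1, unitVec])
      (by simp [h2, unitVec]))⟩
  · exact ⟨1, Or.inr (hq _ (by simp [h0, unitVec]) (by simp [h1, unitVec])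
      (by simp [h2, unitVec]))⟩
  · exact ⟨0, Or.inr (hq _ (by simp [h0, unitVec]) (by simp [h1, unitVec])
      (by simp [h2, unitVec]))⟩

theorem Is1Cell.card {e : Finset Pt} (h : Is1Cell e) : e.card = 2 := by
  obtain ⟨p, q, hpq, rfl⟩ := h
  exact Finset.card_pair hpq.ne

/-- The four corners of a 2-cell, together with the adjacencies between them. -/
theorem Is2Cell.exists_corners {c : Finset Pt} (hc : Is2Cell c) :
    ∃ x u v w, c = {x, u, v, w} ∧ Adj6 x u ∧ Adj6 x v ∧ Adj6 u w ∧ Adj6 v w ∧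
      ¬ Adj6 x w ∧ ¬ Adj6 u v ∧ x ≠ w ∧ u ≠ v ∧ u + v = x + w := by
  obtain ⟨x, i, j, hij, rfl⟩ := hc
  refine ⟨x, _, _, _, rfl, adj6_add_unitVec x i, adj6_add_unitVec x j, adj6_add_unitVec _ j,
    ?_, not_adj6_add_unitVec_add_unitVec x hij, not_adj6_unitVec_unitVec x hij, ?_, ?_, ?_⟩
  · rw [add_right_comm]
    exact adj6_add_unitVec _ i
  · simpa [add_assoc] using unitVec_add_unitVec_ne_zero i j
  · simpa using unitVec_injective.ne hij
  · abel

/-- A 2-cell is determined by one of its points and the two neighbours of that point. -/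
theorem Is2Cell.exists_eq {c : Finset Pt} (hc : Is2Cell c) {p a : Pt} (hp : p ∈ c) (ha : a ∈ c)
    (h : Adj6 p a) : ∃ n, Adj6 p n ∧ n ≠ a ∧ c = {p, a, n, a + n - p} := by
  obtain ⟨x, u, v, w, rfl, hxu, hxv, huw, hvw, hxw, huv, hxw', huv', hrel⟩ := hc.exists_corners
  have main : ∀ {n r : Pt}, Adj6 p n → n ≠ a → a + n = r + p →
      ({x, u, v, w} : Finset Pt) = {p, a, n, r} →
      ∃ n, Adj6 p n ∧ n ≠ a ∧ ({x, u, v, w} : Finset Pt) = {p, a, n, a + n - p} :=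
    fun {n r} h₁ h₂ h₃ h₄ => ⟨n, h₁, h₂, by rwa [sub_eq_of_eq_add h₃]⟩
  have hwx : w + x = u + v := by rw [hrel, add_comm]
  have hvu : v + u = x + w := by rw [← hrel, add_comm]
  have hwx' : w + x = v + u := by rw [hvu, add_comm]
  have hw : x + w = v + u := hvu.symm
  simp only [Finset.mem_insert, Finset.mem_singleton] at hp ha
  rcases hp with hp | hp | hp | hp <;> rcases ha with ha | ha | ha | ha <;>
    rw [hp, ha] at h main ⊢
  · exact absurd h (not_adj6_self x)
  · exact main hxv huv'.symm (hwx.symm) rfl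
  · exact main hxu huv' hwx'.symm (by grind)
  · exact absurd h hxw
  · exact main huw hxw'.symm hw (by grind)
  · exact absurd h (not_adj6_self u)
  · exact absurd h huv
  · exact main hxu.symm hxw' hwx' (by grind)
  · exact main hvw hxw'.symm hrel.symm (by grind)
  · exact absurd h.symm huv
  · exact absurd h (not_adj6_self v)
  · exact main hxv.symm hxw' hwx (by grind)
  · exact absurd h.symm hxw
  · exact main hvw.symm huv'.symm hrel (by grind)
  · exact main huw.symm huv' hvu (by grind)
  · exact absurd h (not_adj6_self w)

theorem Is2Cell.card {c : Finset Pt} (hc : Is2Cell c) : c.card = 4 := by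
  obtain ⟨x, u, v, w, rfl, hxu, hxv, huw, hvw, -, -, hxw, huv, -⟩ := hc.exists_corners
  rw [Finset.card_insert_of_notMem, Finset.card_insert_of_notMem, Finset.card_pair hvw.ne]
  · simp [huv, huw.ne]
  · simp [hxu.ne, hxv.ne, hxw]

theorem Is2Cell.is1Cell_sdiff {c e : Finset Pt} (hc : Is2Cell c) (he : Is1Cell e) (hec : e ⊆ c) :
    Is1Cell (c \ e) := by
  obtain ⟨p, a, hpa, rfl⟩ := he
  obtain ⟨n, hn, -, hcn⟩ := hc.exists_eq (hec (by simp)) (hec (by simp)) hpa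
  refine ⟨n, a + n - p, ?_, ?_⟩
  · unfold Adj6 at hpa ⊢
    rw [← hpa]
    exact Finset.sum_congr rfl fun i _ => by simp only [Pi.add_apply, Pi.sub_apply]; ring
  · have hsub : c \ {p, a} ⊆ {n, a + n - p} := by
      intro x hx
      rw [hcn] at hx
      simp only [Finset.mem_sdiff, Finset.mem_insert, Finset.mem_singleton] at hx ⊢
      tauto
    refine Finset.eq_of_subset_of_card_le hsub ?_
    rw [Finset.card_sdiff_of_subset hec, hc.card, Finset.card_pair hpa.ne]
    exact Finset.card_le_two

/-- Parallel-moves of a 1-cell correspond to the 2-cells containing it. -/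
theorem ncard_parallelMove (S : Set Pt) {e : Finset Pt} (he : Is1Cell e) :
    {e' | ParallelMove S e e'}.ncard = {c | TwoCellIn S c ∧ e ⊆ c}.ncard := by
  refine Set.ncard_congr (fun e' _ => e ∪ e') ?_ ?_ ?_
  · exact fun e' h => ⟨⟨h.2.1, h.2.2⟩, Finset.subset_union_left⟩
  · have key : ∀ e', ParallelMove S e e' → (e ∪ e') \ e = e' := fun e' h => by
      refine Finset.union_sdiff_cancel_left (Finset.card_union_eq_card_add_card.1 ?_)
      rw [h.2.1.card, he.card, h.1.card]
    intro x y hx hy hxy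
    rw [← key x hx, ← key y hy]
    exact congrArg (· \ e) hxy
  · rintro c ⟨⟨hc, hcS⟩, hec⟩
    have hu : e ∪ c \ e = c := Finset.union_sdiff_of_subset hec
    exact ⟨c \ e, ⟨hc.is1Cell_sdiff he hec, by rwa [hu], by rwa [hu]⟩, hu⟩

theorem Is2Cell.card_filter_is1Cell [DecidablePred Is1Cell] {c : Finset Pt} (hc : Is2Cell c) :
    (c.powerset.filter Is1Cell).card = 4 := by
  obtain ⟨x, u, v, w, rfl, hi, hj, hij', hji', hd, hd', hs, hne, -⟩ := hc.exists_corners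
  have h1 := hi.ne
  have h2 := hj.ne
  have h3 := hij'.ne
  have hset : (({x, u, v, w} : Finset Pt).powerset.filter Is1Cell)
      = {{x, u}, {x, v}, {u, w}, {v, w}} := by
    ext e
    simp only [Finset.mem_filter, Finset.mem_powerset, Finset.mem_insert, Finset.mem_singleton]
    constructor
    · rintro ⟨hsub, p, q, hpq, rfl⟩
      have hp := hsub (Finset.mem_insert_self p _)
      have hq := hsub (Finset.mem_insert_of_mem (Finset.mem_singleton_self q))
      have hqp := hpq.symm
      simp only [Finset.mem_insert, Finset.mem_singleton] at hp hq
      rcases hp with rfl | rfl | rfl | rfl <;> rcases hq with rfl | rfl | rfl | rfl <;>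
        first
        | exact (hpq.ne rfl).elim
        | exact absurd hpq hd
        | exact absurd hpq hd'
        | exact absurd hqp hd
        | exact absurd hqp hd'
        | simp [Finset.pair_comm]
    · rintro (rfl | rfl | rfl | rfl)
      · exact ⟨by simp [Finset.insert_subset_iff], _, _, hi, rfl⟩
      · exact ⟨by simp [Finset.insert_subset_iff], _, _, hj, rfl⟩
      · exact ⟨by simp [Finset.insert_subset_iff], _, _, hij', rfl⟩
      · exact ⟨by simp [Finset.insert_subset_iff], _, _, hji', rfl⟩
  have pair_ne : ∀ {a b c d : Pt}, a ≠ c → a ≠ d → ({a, b} : Finset Pt) ≠ {c, d} := by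
    intro a b c d hac had h
    have : a ∈ ({c, d} : Finset Pt) := h ▸ Finset.mem_insert_self a _
    simp [hac, had] at this
  have e1 : ({x, u} : Finset Pt) ≠ {x, v} := by
    rw [Finset.pair_comm]; exact pair_ne h1.symm hne
  have e3 : ({x, v} : Finset Pt) ≠ {v, w} := by
    rw [Finset.pair_comm v w]; exact pair_ne hs h2
  have e4 : ({x, u} : Finset Pt) ≠ {u, w} := pair_ne h1 hs
  have e2 : ({u, w} : Finset Pt) ≠ {v, w} := pair_ne hne h3
  rw [hset, Finset.card_insert_of_notMem, Finset.card_insert_of_notMem, Finset.card_pair e2]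
  · simp [pair_ne (b := v) h1 hs, e3]
  · simp [e1, pair_ne (b := u) h2 hs, e4]

theorem finite_setOf_adj6 (p : Pt) : {q | Adj6 p q}.Finite ∧ {q | Adj6 p q}.ncard ≤ 6 := by
  set N : Finset Pt := Finset.univ.image (fun i => p + unitVec i) ∪
    Finset.univ.image (fun i => p - unitVec i) with hN
  have hsub : {q | Adj6 p q} ⊆ (N : Set Pt) := by
    intro q hq
    obtain ⟨i, hi | hi⟩ := Adj6.exists_unitVec hq <;> simp [hN, hi]
  have hcard : N.card ≤ 6 :=
    (Finset.card_union_le _ _).trans (add_le_add Finset.card_image_le Finset.card_image_le)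
  refine ⟨N.finite_toSet.subset hsub, (Set.ncard_le_ncard hsub).trans ?_⟩
  rwa [Set.ncard_coe_finset]

theorem deg6_le_six (S : Set Pt) (p : Pt) : deg6 S p ≤ 6 :=
  (Set.ncard_le_ncard (fun _ hq => hq.2) (finite_setOf_adj6 p).1).trans (finite_setOf_adj6 p).2

theorem Is2Cell.exists_adj6 {c : Finset Pt} (hc : Is2Cell c) {p : Pt} (hp : p ∈ c) :
    ∃ a ∈ c, Adj6 p a := by
  obtain ⟨x, i, j, -, rfl⟩ := hc
  simp only [Finset.mem_insert, Finset.mem_singleton] at hp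
  rcases hp with rfl | rfl | rfl | rfl
  · exact ⟨_, by simp, adj6_add_unitVec _ i⟩
  · exact ⟨_, by simp, adj6_add_unitVec _ j⟩
  · exact ⟨x, by simp, (adj6_add_unitVec _ j).symm⟩
  · exact ⟨x + unitVec i, by simp, (adj6_add_unitVec _ j).symm⟩

theorem IsClosedDigitalSurface.ncard_twoCellIn {S : Set Pt} (hS : IsClosedDigitalSurface S)
    {e : Finset Pt} (he : Is1Cell e) (heS : (↑e : Set Pt) ⊆ S) :
    {c | TwoCellIn S c ∧ e ⊆ c}.ncard = 2 :=
  (ncard_parallelMove S he).symm.trans (hS.2 e he heS)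

theorem IsClosedDigitalSurface.three_le_deg6 {S : Set Pt} (hS : IsClosedDigitalSurface S)
    {p : Pt} (hp : p ∈ S) : 3 ≤ deg6 S p := by
  obtain ⟨c, hc, hpc, hcS⟩ := hS.1.2.1 p hp
  obtain ⟨a, hac, hpa⟩ := hc.exists_adj6 hpc
  have haS : a ∈ S := hcS hac
  have hcard := hS.ncard_twoCellIn (e := {p, a}) ⟨p, a, hpa, rfl⟩
    (by simp [Set.insert_subset_iff, hp, haS])
  obtain ⟨c₁, c₂, hne, hset⟩ := Set.ncard_eq_two.1 hcard
  have h₁ : c₁ ∈ {c | TwoCellIn S c ∧ {p, a} ⊆ c} := by simp [hset]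
  have h₂ : c₂ ∈ {c | TwoCellIn S c ∧ {p, a} ⊆ c} := by simp [hset]
  obtain ⟨⟨hc₁, hS₁⟩, hs₁⟩ := h₁
  obtain ⟨⟨hc₂, hS₂⟩, hs₂⟩ := h₂
  obtain ⟨n₁, ha₁, hn₁, he₁⟩ := hc₁.exists_eq (hs₁ (by simp)) (hs₁ (by simp)) hpa
  obtain ⟨n₂, ha₂, hn₂, he₂⟩ := hc₂.exists_eq (hs₂ (by simp)) (hs₂ (by simp)) hpa
  have hn : n₁ ≠ n₂ := by
    rintro rfl
    exact hne (he₁.trans he₂.symm)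
  have hm₁ : n₁ ∈ S := hS₁ (by simp [he₁])
  have hm₂ : n₂ ∈ S := hS₂ (by simp [he₂])
  have hthree : (({a, n₁, n₂} : Finset Pt) : Set Pt).ncard = 3 := by
    rw [Set.ncard_coe_finset]
    exact Finset.card_eq_three.2 ⟨a, n₁, n₂, hn₁.symm, hn₂.symm, hn, rfl⟩
  rw [← hthree]
  refine Set.ncard_le_ncard ?_ ((finite_setOf_adj6 p).1.subset fun _ hq => hq.2)
  intro q hq
  simp only [Finset.coe_insert, Finset.coe_singleton, Set.mem_insert_iff,
    Set.mem_singleton_iff] at hq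
  rcases hq with rfl | rfl | rfl
  exacts [⟨haS, hpa⟩, ⟨hm₁, ha₁⟩, ⟨hm₂, ha₂⟩]

/-- The 1-cells of `S` at a point of `S` correspond to its neighbours in `S`. -/
theorem ncard_is1Cell_mem {S : Set Pt} {p : Pt} (hp : p ∈ S) :
    {e : Finset Pt | (Is1Cell e ∧ (↑e : Set Pt) ⊆ S) ∧ p ∈ e}.ncard = deg6 S p := by
  symm
  refine Set.ncard_congr (fun q _ => {p, q}) ?_ ?_ ?_
  · rintro q ⟨hq, hpq⟩
    exact ⟨⟨⟨p, q, hpq, rfl⟩, by simp [Set.insert_subset_iff, hp, hq]⟩, by simp⟩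
  · rintro q r ⟨-, hq⟩ ⟨-, hr⟩ h
    have : q ∈ ({p, r} : Finset Pt) := h ▸ (by simp)
    simpa [hq.ne.symm] using this
  · rintro e ⟨⟨⟨a, b, hab, rfl⟩, hS⟩, hpe⟩
    simp only [Finset.coe_insert, Finset.coe_singleton, Set.insert_subset_iff,
      Set.singleton_subset_iff] at hS
    simp only [Finset.mem_insert, Finset.mem_singleton] at hpe
    rcases hpe with rfl | rfl
    · exact ⟨b, ⟨hS.2, hab⟩, rfl⟩
    · exact ⟨a, ⟨hS.1, hab.symm⟩, Finset.pair_comm _ _⟩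

open Classical in
theorem sum_deg6 (S : Finset Pt) :
    ∑ p ∈ S, deg6 S p = 2 * (S.powerset.filter Is1Cell).card := by
  have h := Finset.sum_card_bipartiteAbove_eq_sum_card_bipartiteBelow
    (fun (p : Pt) (e : Finset Pt) => p ∈ e) (s := S) (t := S.powerset.filter Is1Cell)
  have hl : ∀ p ∈ S, ((S.powerset.filter Is1Cell).bipartiteAbove
      (fun (p : Pt) (e : Finset Pt) => p ∈ e) p).card = deg6 S p := fun p hp => by
    rw [← ncard_is1Cell_mem (S := (S : Set Pt)) hp, ← Set.ncard_coe_finset]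
    congr 1
    ext e
    simp [Finset.bipartiteAbove, and_comm]
  have hr : ∀ e ∈ S.powerset.filter Is1Cell, (S.bipartiteBelow
      (fun (p : Pt) (e : Finset Pt) => p ∈ e) e).card = 2 := fun e he => by
    simp only [Finset.mem_filter, Finset.mem_powerset] at he
    rw [← he.2.card, Finset.bipartiteBelow, Finset.filter_mem_eq_inter,
      Finset.inter_eq_right.2 he.1]
  rw [Finset.sum_congr rfl hl, Finset.sum_congr rfl hr, Finset.sum_const, smul_eq_mul] at h
  rw [h, mul_comm]

open Classical in
theorem card_is1Cell_eq_two_mul_card_is2Cell {S : Finset Pt}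
    (hS : IsClosedDigitalSurface (S : Set Pt)) :
    (S.powerset.filter Is1Cell).card = 2 * (S.powerset.filter Is2Cell).card := by
  have h := Finset.card_mul_eq_card_mul (s := S.powerset.filter Is1Cell)
    (t := S.powerset.filter Is2Cell) (fun e c : Finset Pt => e ⊆ c) (m := 2) (n := 4) ?_ ?_
  · omega
  · intro e he
    simp only [Finset.mem_filter, Finset.mem_powerset] at he
    rw [← hS.ncard_twoCellIn he.2 (by exact_mod_cast he.1), ← Set.ncard_coe_finset]
    congr 1
    ext c
    simp [Finset.bipartiteAbove, TwoCellIn, and_comm]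
  · intro c hc
    simp only [Finset.mem_filter, Finset.mem_powerset] at hc
    rw [← hc.2.card_filter_is1Cell]
    congr 1
    ext e
    simp only [Finset.bipartiteBelow, Finset.mem_filter, Finset.mem_powerset]
    exact ⟨fun h => ⟨h.2, h.1.2⟩, fun h => ⟨⟨h.1.trans hc.1, h.2⟩, h.1⟩⟩

/-- **Genus formula for closed digital surfaces (Chen–Rong).**
For a closed parallel-move based digital surface `M` in ℤ³, with
`Mᵢ` the set of points of `M` having exactly `i` directly adjacent points in `M`,
`χ(M) = V - E + F` and `g = 1 - χ(M)/2`, one has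
`g = 1 + (|M₅| + 2|M₆| - |M₃|)/8`. -/
theorem genus_formula (M : Set Pt) (hM : IsClosedDigitalSurface M) (hfin : M.Finite)
    (V E F : ℕ)
    (hV : V = M.ncard)
    (hE : E = {e : Finset Pt | Is1Cell e ∧ (↑e : Set Pt) ⊆ M}.ncard)
    (hF : F = {c : Finset Pt | Is2Cell c ∧ (↑c : Set Pt) ⊆ M}.ncard)
    (χ g : ℚ)
    (hχ : χ = (V : ℚ) - (E : ℚ) + (F : ℚ))
    (hg : g = 1 - χ / 2) :
    g = 1 + (({p ∈ M | deg6 M p = 5}.ncard : ℚ)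
              + 2 * ({p ∈ M | deg6 M p = 6}.ncard : ℚ)
              - ({p ∈ M | deg6 M p = 3}.ncard : ℚ)) / 8 := by
  classical
  lift M to Finset Pt using hfin
  have hE' : E = (M.powerset.filter Is1Cell).card := by
    rw [hE, ← Set.ncard_coe_finset]
    congr 1
    ext e
    simp [and_comm]
  have hF' : F = (M.powerset.filter Is2Cell).card := by
    rw [hF, ← Set.ncard_coe_finset]
    congr 1
    ext c
    simp [and_comm]
  have hV' : V = M.card := by rw [hV, Set.ncard_coe_finset]
  have hEF : E = 2 * F := by rw [hE', hF', card_is1Cell_eq_two_mul_card_is2Cell hM]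
  have hdeg : ∑ p ∈ M, deg6 M p = 2 * E := by rw [hE', sum_deg6]
  have hcount : ∀ i : ℕ, (({p ∈ (M : Set Pt) | deg6 M p = i}.ncard : ℕ) : ℚ)
      = ∑ p ∈ M, if deg6 M p = i then 1 else 0 := fun i => by
    rw [Finset.sum_boole, ← Set.ncard_coe_finset]
    congr 2
    ext p
    simp
  have hlocal : ∀ p ∈ M, (deg6 M p : ℚ) - 4 = (if deg6 M p = 5 then 1 else 0)
      + 2 * (if deg6 M p = 6 then 1 else 0) - (if deg6 M p = 3 then 1 else 0) := fun p hp => by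
    have h₁ := hM.three_le_deg6 (p := p) hp
    have h₂ := deg6_le_six M p
    generalize deg6 M p = d at *
    interval_cases d <;> norm_num
  have hsum := Finset.sum_congr rfl hlocal
  rw [Finset.sum_sub_distrib, Finset.sum_sub_distrib, Finset.sum_add_distrib, ← Finset.mul_sum,
    ← hcount, ← hcount, ← hcount, Finset.sum_const, nsmul_eq_mul, ← Nat.cast_sum, hdeg,
    ← hV'] at hsum
  have hEF' : (E : ℚ) = 2 * F := by exact_mod_cast hEF
  push_cast at hsum
  rw [hg, hχ]
  linarith
end

section
/- Let P ⊆ ℤ² be a finite nonempty 4-connected set of pixels and let R ⊆ ℝ² be the union of the closed unit squares [p₁ − 1/2, p₁ + 1/2] × [p₂ − 1/2, p₂ + 1/2] over p ∈ P. Assume the topological boundary ∂R is a disjoint union of simple closed curves (i.e., R has no pinch points: no vertex of the grid is met by exactly two squares of R touching only diagonally). Let Out_p be the number of outward corner points of ∂R (grid vertices where exactly one square of R meets, i.e., convex 90° corners) and In_p the number of inward corner points (grid vertices where exactly three squares of R meet, i.e., reflex 270° corners). Then the number h of bounded connected components of ℝ² \ R (the number of holes of the object) satisfies h = 1 + (In_p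 − Out_p)/4. -/
/-- 4-adjacency on ℤ². -/
def Adj4 (p q : ℤ × ℤ) : Prop := |p.1 - q.1| + |p.2 - q.2| = 1

/-- `P` is 4-connected. -/
def IsConn4 (P : Set (ℤ × ℤ)) : Prop :=
  ∀ p ∈ P, ∀ q ∈ P,
    Relation.ReflTransGen (fun a b => a ∈ P ∧ b ∈ P ∧ Adj4 a b) p q

/-- The closed unit square (pixel) centered at the grid point `p`. -/
def pixel (p : ℤ × ℤ) : Set (ℝ × ℝ) :=
  Set.Icc ((p.1 : ℝ) - 1/2) ((p.1 : ℝ) + 1/2) ×ˢ Set.Icc ((p.2 : ℝ) - 1/2) ((p.2 : ℝ) + 1/2)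

/-- The union of the pixels of `P`. -/
def pixelRegion (P : Set (ℤ × ℤ)) : Set (ℝ × ℝ) := ⋃ p ∈ P, pixel p

/-- The number of squares of `P` meeting the grid vertex `(a + 1/2, b + 1/2)`,
i.e. the number of points of `{(a,b), (a+1,b), (a,b+1), (a+1,b+1)}` lying in `P`. -/
noncomputable def cornerCount (P : Set (ℤ × ℤ)) (a b : ℤ) : ℕ :=
  (({(a, b), (a + 1, b), (a, b + 1), (a + 1, b + 1)} : Set (ℤ × ℤ)) ∩ P).ncard

/-- `P` has no pinch points: no grid vertex is met by exactly two squares of `P`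
touching only diagonally.  Hence the boundary of the pixel region is a disjoint
union of simple closed curves. -/
def NoPinch (P : Set (ℤ × ℤ)) : Prop :=
  ∀ a b : ℤ,
    ¬ (((a, b) ∈ P ∧ (a + 1, b + 1) ∈ P ∧ (a + 1, b) ∉ P ∧ (a, b + 1) ∉ P) ∨
       ((a + 1, b) ∈ P ∧ (a, b + 1) ∈ P ∧ (a, b) ∉ P ∧ (a + 1, b + 1) ∉ P))

/-- Grid vertices (`v` stands for the vertex `(v.1 + 1/2, v.2 + 1/2)`) that are the endpoints of a
common grid edge not separating two pixels of `P`. -/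
def VertexAdj (P : Set (ℤ × ℤ)) (v w : ℤ × ℤ) : Prop :=
  (w = (v.1, v.2 + 1) ∧ ¬((v.1, v.2 + 1) ∈ P ∧ (v.1 + 1, v.2 + 1) ∈ P)) ∨
  (w = (v.1 + 1, v.2) ∧ ¬((v.1 + 1, v.2) ∈ P ∧ (v.1 + 1, v.2 + 1) ∈ P))

/-- The faces of the pixel adjacency graph of `P`, as classes of grid vertices. -/
abbrev Face (P : Set (ℤ × ℤ)) : Type := Quot (VertexAdj P)

/-- The face containing a grid vertex. -/
abbrev face (P : Set (ℤ × ℤ)) (v : ℤ × ℤ) : Face P := Quot.mk _ v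

theorem face_up {P : Set (ℤ × ℤ)} {x y : ℤ} (h : ¬((x, y) ∈ P ∧ (x + 1, y) ∈ P)) :
    face P (x, y) = face P (x, y - 1) :=
  (Quot.sound (show VertexAdj P _ _ from Or.inl ⟨by simp, by simpa using h⟩)).symm

theorem face_right {P : Set (ℤ × ℤ)} {x y : ℤ} (h : ¬((x, y) ∈ P ∧ (x, y + 1) ∈ P)) :
    face P (x, y) = face P (x - 1, y) :=
  (Quot.sound (show VertexAdj P _ _ from Or.inr ⟨by simp, by simpa using h⟩)).symm

theorem int_const_of_step {α : Type*} {f : ℤ → α} (h : ∀ n, f n = f (n - 1)) (m n : ℤ) :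
    f m = f n := by
  have key : ∀ n, f n = f 0 := by
    intro n
    induction n using Int.induction_on with
    | zero => rfl
    | succ i ih => rw [h, ← ih]; congr 1; ring
    | pred i ih => rw [← h, ih]
  rw [key m, key n]

theorem exists_int_antideriv (f : ℤ → ℚ) : ∃ F : ℤ → ℚ, ∀ n, F n - F (n - 1) = f n := by
  refine ⟨fun n => (∑ i ∈ Finset.Ioc 0 n, f i) - ∑ i ∈ Finset.Ioc n 0, f i, fun n => ?_⟩
  rcases le_or_gt 1 n with hn | hn
  · have h1 : Finset.Ioc 0 n = insert n (Finset.Ioc 0 (n - 1)) := by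
      ext i; simp only [Finset.mem_Ioc, Finset.mem_insert]; omega
    have h2 : Finset.Ioc n 0 = ∅ := Finset.Ioc_eq_empty (by omega)
    have h3 : Finset.Ioc (n - 1) 0 = ∅ := Finset.Ioc_eq_empty (by omega)
    simp [h1, h2, h3]
  · have h1 : Finset.Ioc (n - 1) 0 = insert n (Finset.Ioc n 0) := by
      ext i; simp only [Finset.mem_Ioc, Finset.mem_insert]; omega
    have h2 : Finset.Ioc 0 n = ∅ := Finset.Ioc_eq_empty (by omega)
    have h3 : Finset.Ioc 0 (n - 1) = ∅ := Finset.Ioc_eq_empty (by omega)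
    simp [h1, h2, h3]

/-- Discrete Poincaré lemma: a divergence-free flow on the grid `ℤ²` has a potential on the
dual grid. -/
theorem exists_grid_potential (A B : ℤ → ℤ → ℚ)
    (h : ∀ x y, A x y - A (x - 1) y + B x y - B x (y - 1) = 0) :
    ∃ G : ℤ → ℤ → ℚ, (∀ x y, G x y - G x (y - 1) = A x y) ∧
      ∀ x y, G (x - 1) y - G x y = B x y := by
  choose R hR using fun y => exists_int_antideriv fun x => - B x y
  obtain ⟨C, hC⟩ := exists_int_antideriv fun y => A 0 y - (R y 0 - R (y - 1) 0)
  refine ⟨fun x y => R y x + C y, fun x y => ?_, fun x y => ?_⟩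
  · have := int_const_of_step (f := fun x => A x y - (R y x - R (y - 1) x))
      (fun n => by have := hR y n; have := hR (y - 1) n; have := h n y; linarith) x 0
    have := hC y
    linarith
  · have := hR y x
    linarith

section Euler

variable (P : Finset (ℤ × ℤ))

/-- Left pixels of the horizontally adjacent pairs of pixels of `P`. -/
def hEdges : Finset (ℤ × ℤ) := P.filter fun p => (p.1 + 1, p.2) ∈ P

/-- Lower pixels of the vertically adjacent pairs of pixels of `P`. -/
def vEdges : Finset (ℤ × ℤ) := P.filter fun p => (p.1, p.2 + 1) ∈ P

/-- Rational flows on the pixel adjacency graph of `P`. -/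
abbrev PixelFlow : Type := (hEdges P → ℚ) × (vEdges P → ℚ)

/-- Extension by zero from a finset of grid points. -/
noncomputable abbrev zeroExt {S : Finset (ℤ × ℤ)} : (S → ℚ) →ₗ[ℚ] (ℤ × ℤ → ℚ) :=
  Function.ExtendByZero.linearMap ℚ Subtype.val

theorem zeroExt_mem {S : Finset (ℤ × ℤ)} (a : S → ℚ) {p : ℤ × ℤ} (hp : p ∈ S) :
    zeroExt a p = a ⟨p, hp⟩ :=
  Subtype.val_injective.extend_apply a 0 ⟨p, hp⟩

theorem zeroExt_notMem {S : Finset (ℤ × ℤ)} (a : S → ℚ) {p : ℤ × ℤ} (hp : p ∉ S) :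
    zeroExt a p = 0 :=
  Function.extend_apply' _ _ _ (by simpa using hp)

/-- The net outflow at the grid point `p`. -/
noncomputable def gridDiv (p : ℤ × ℤ) : PixelFlow P →ₗ[ℚ] ℚ where
  toFun ω := zeroExt ω.1 p - zeroExt ω.1 (p.1 - 1, p.2) + zeroExt ω.2 p
    - zeroExt ω.2 (p.1, p.2 - 1)
  map_add' ω η := by simp only [Prod.fst_add, Prod.snd_add, map_add, Pi.add_apply]; ring
  map_smul' c ω := by
    simp only [Prod.smul_fst, Prod.smul_snd, map_smul, Pi.smul_apply, smul_eq_mul,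
      RingHom.id_apply]
    ring

/-- The net outflow at the pixels of `P`. -/
noncomputable def flowDiv : PixelFlow P →ₗ[ℚ] (P → ℚ) := LinearMap.pi fun p => gridDiv P p

/-- The flow with potential `g` on the faces. -/
def flowOfFace : (Face (P : Set (ℤ × ℤ)) → ℚ) →ₗ[ℚ] PixelFlow P where
  toFun g := (fun p => g (face P p) - g (face P (p.1.1, p.1.2 - 1)),
    fun p => g (face P (p.1.1 - 1, p.1.2)) - g (face P p))
  map_add' f g := by ext <;> simp <;> ring
  map_smul' c f := by ext <;> simp <;> ring

variable {P}

theorem mem_hEdges {x y : ℤ} : (x, y) ∈ hEdges P ↔ (x, y) ∈ P ∧ (x + 1, y) ∈ P := by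
  simp [hEdges]

theorem mem_vEdges {x y : ℤ} : (x, y) ∈ vEdges P ↔ (x, y) ∈ P ∧ (x, y + 1) ∈ P := by
  simp [vEdges]

theorem zeroExt_flowOfFace_fst (g : Face (P : Set (ℤ × ℤ)) → ℚ) (x y : ℤ) :
    zeroExt (flowOfFace P g).1 (x, y) = g (face P (x, y)) - g (face P (x, y - 1)) := by
  by_cases h : (x, y) ∈ hEdges P
  · rw [zeroExt_mem _ h]; rfl
  · rw [zeroExt_notMem _ h, face_up (by simpa [mem_hEdges] using h), sub_self]

theorem zeroExt_flowOfFace_snd (g : Face (P : Set (ℤ × ℤ)) → ℚ) (x y : ℤ) :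
    zeroExt (flowOfFace P g).2 (x, y) = g (face P (x - 1, y)) - g (face P (x, y)) := by
  by_cases h : (x, y) ∈ vEdges P
  · rw [zeroExt_mem _ h]; rfl
  · rw [zeroExt_notMem _ h, face_right (x := x) (by simpa [mem_vEdges] using h), sub_self]

theorem gridDiv_eq_zero_of_notMem (ω : PixelFlow P) {x y : ℤ} (hp : (x, y) ∉ P) :
    gridDiv P (x, y) ω = 0 := by
  have h1 : (x, y) ∉ hEdges P := by simp [mem_hEdges, hp]
  have h2 : (x - 1, y) ∉ hEdges P := by simp [mem_hEdges, hp]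
  have h3 : (x, y) ∉ vEdges P := by simp [mem_vEdges, hp]
  have h4 : (x, y - 1) ∉ vEdges P := by simp [mem_vEdges, hp]
  simp [gridDiv, -Function.ExtendByZero.linearMap_apply, zeroExt_notMem _ h1,
    zeroExt_notMem _ h2, zeroExt_notMem _ h3, zeroExt_notMem _ h4]

theorem range_flowOfFace : LinearMap.range (flowOfFace P) = LinearMap.ker (flowDiv P) := by
  ext ω
  rw [LinearMap.mem_range, LinearMap.mem_ker]
  constructor
  · rintro ⟨g, rfl⟩
    ext ⟨⟨x, y⟩, hp⟩
    simp only [flowDiv, gridDiv, LinearMap.pi_apply, LinearMap.coe_mk, AddHom.coe_mk,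
      zeroExt_flowOfFace_fst, zeroExt_flowOfFace_snd, Pi.zero_apply]
    ring
  · intro h
    obtain ⟨G, hA, hB⟩ := exists_grid_potential (fun x y => zeroExt ω.1 (x, y))
      (fun x y => zeroExt ω.2 (x, y)) (fun x y => by
        by_cases hp : (x, y) ∈ P
        · exact congrFun h ⟨(x, y), hp⟩
        · exact gridDiv_eq_zero_of_notMem ω hp)
    refine ⟨Quot.lift (fun v => G v.1 v.2) ?_, ?_⟩
    · rintro ⟨x, y⟩ w (⟨rfl, hw⟩ | ⟨rfl, hw⟩)
      · have h1 := hA x (y + 1)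
        rw [zeroExt_notMem _ (by simpa [mem_hEdges] using hw), add_sub_cancel_right] at h1
        exact (sub_eq_zero.1 h1).symm
      · have h1 := hB (x + 1) y
        rw [zeroExt_notMem _ (by simpa [mem_vEdges] using hw), add_sub_cancel_right] at h1
        exact sub_eq_zero.1 h1
    · refine Prod.ext (funext fun p => ?_) (funext fun p => ?_)
      · exact (hA p.1.1 p.1.2).trans (zeroExt_mem _ p.2)
      · exact (hB p.1.1 p.1.2).trans (zeroExt_mem _ p.2)

theorem ker_flowOfFace :
    LinearMap.ker (flowOfFace P) = Submodule.span ℚ {fun _ => (1 : ℚ)} := by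
  ext g
  rw [LinearMap.mem_ker, Submodule.mem_span_singleton]
  constructor
  · intro h
    have hA : ∀ x y, g (face P (x, y)) = g (face P (x, y - 1)) := fun x y => by
      rw [← sub_eq_zero, ← zeroExt_flowOfFace_fst, h]
      exact congrFun (map_zero zeroExt) _
    have hB : ∀ x y, g (face P (x, y)) = g (face P (x - 1, y)) := fun x y => by
      rw [eq_comm, ← sub_eq_zero, ← zeroExt_flowOfFace_snd, h]
      exact congrFun (map_zero zeroExt) _
    refine ⟨g (face P (0, 0)), funext fun c => ?_⟩
    obtain ⟨⟨x, y⟩, rfl⟩ := Quot.exists_rep c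
    have h1 := int_const_of_step (hA x) y 0
    have h2 := int_const_of_step (f := fun x => g (face P (x, 0))) (fun x => hB x 0) x 0
    simpa [h1] using h2.symm
  · rintro ⟨c, rfl⟩
    ext <;> simp [flowOfFace]

theorem finrank_ker_flowDiv [Finite (Face (P : Set (ℤ × ℤ)))] :
    Module.finrank ℚ (LinearMap.ker (flowDiv P)) + 1 = Nat.card (Face (P : Set (ℤ × ℤ))) := by
  have := Fintype.ofFinite (Face (P : Set (ℤ × ℤ)))
  have h := (flowOfFace P).finrank_range_add_finrank_ker
  rw [range_flowOfFace, ker_flowOfFace, finrank_span_singleton, Module.finrank_pi] at h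
  · rw [h, Nat.card_eq_fintype_card]
  · intro h0
    exact one_ne_zero (congrFun h0 (face P (0, 0)))

/-- The unit mass at a grid point, restricted to `P`. -/
def unitMass (P : Finset (ℤ × ℤ)) (q : ℤ × ℤ) : P → ℚ := fun p => if p.1 = q then 1 else 0

theorem unitMass_sub_mem_right {x y : ℤ} (hp : (x, y) ∈ P) (hq : (x + 1, y) ∈ P) :
    unitMass P (x, y) - unitMass P (x + 1, y) ∈ LinearMap.range (flowDiv P) := by
  have he : (x, y) ∈ hEdges P := mem_hEdges.2 ⟨hp, hq⟩
  have hval : ∀ z : ℤ × ℤ, zeroExt (Pi.single (⟨(x, y), he⟩ : hEdges P) (1 : ℚ)) z =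
      if z = (x, y) then 1 else 0 := fun z => by
    by_cases hz : z ∈ hEdges P
    · rw [zeroExt_mem _ hz, Pi.single_apply]; simp
    · rw [zeroExt_notMem _ hz, if_neg (by rintro rfl; exact hz he)]
  refine ⟨(Pi.single ⟨(x, y), he⟩ 1, 0), ?_⟩
  ext ⟨⟨a, b⟩, h⟩
  simp only [flowDiv, gridDiv, LinearMap.pi_apply, LinearMap.coe_mk, AddHom.coe_mk, hval,
    map_zero, Pi.zero_apply, unitMass, Pi.sub_apply, Prod.mk.injEq, sub_eq_iff_eq_add]

theorem unitMass_sub_mem_up {x y : ℤ} (hp : (x, y) ∈ P) (hq : (x, y + 1) ∈ P) :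
    unitMass P (x, y) - unitMass P (x, y + 1) ∈ LinearMap.range (flowDiv P) := by
  have he : (x, y) ∈ vEdges P := mem_vEdges.2 ⟨hp, hq⟩
  have hval : ∀ z : ℤ × ℤ, zeroExt (Pi.single (⟨(x, y), he⟩ : vEdges P) (1 : ℚ)) z =
      if z = (x, y) then 1 else 0 := fun z => by
    by_cases hz : z ∈ vEdges P
    · rw [zeroExt_mem _ hz, Pi.single_apply]; simp
    · rw [zeroExt_notMem _ hz, if_neg (by rintro rfl; exact hz he)]
  refine ⟨(0, Pi.single ⟨(x, y), he⟩ 1), ?_⟩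
  ext ⟨⟨a, b⟩, h⟩
  simp only [flowDiv, gridDiv, LinearMap.pi_apply, LinearMap.coe_mk, AddHom.coe_mk, hval,
    map_zero, Pi.zero_apply, unitMass, Pi.sub_apply, Prod.mk.injEq, sub_eq_iff_eq_add]
  ring

theorem unitMass_sub_mem_of_adj {p q : ℤ × ℤ} (hp : p ∈ P) (hq : q ∈ P) (h : Adj4 p q) :
    unitMass P p - unitMass P q ∈ LinearMap.range (flowDiv P) := by
  obtain ⟨a, b⟩ := p
  obtain ⟨c, d⟩ := q
  have h' : (c = a + 1 ∧ d = b) ∨ (a = c + 1 ∧ d = b) ∨ (c = a ∧ d = b + 1) ∨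
      (c = a ∧ b = d + 1) := by
    simp only [Adj4] at h
    rcases abs_cases (a - c) with ⟨h1, h1'⟩ | ⟨h1, h1'⟩ <;>
      rcases abs_cases (b - d) with ⟨h2, h2'⟩ | ⟨h2, h2'⟩ <;> rw [h1, h2] at h <;> omega
  rcases h' with ⟨rfl, rfl⟩ | ⟨rfl, rfl⟩ | ⟨rfl, rfl⟩ | ⟨rfl, rfl⟩
  · exact unitMass_sub_mem_right hp hq
  · rw [← neg_sub]; exact neg_mem (unitMass_sub_mem_right hq hp)
  · exact unitMass_sub_mem_up hp hq
  · rw [← neg_sub]; exact neg_mem (unitMass_sub_mem_up hq hp)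

theorem unitMass_sub_mem (hconn : IsConn4 (P : Set (ℤ × ℤ))) {p q : ℤ × ℤ} (hp : p ∈ P)
    (hq : q ∈ P) : unitMass P p - unitMass P q ∈ LinearMap.range (flowDiv P) := by
  induction hconn p hp q hq with
  | refl => simp
  | tail _ h ih =>
    rw [← sub_add_sub_cancel]
    exact add_mem (ih h.1) (unitMass_sub_mem_of_adj h.1 h.2.1 h.2.2)

theorem sum_unitMass {q : ℤ × ℤ} (hq : q ∈ P) : ∑ p, unitMass P q p = 1 := by
  have : ∀ p : P, unitMass P q p = if p = ⟨q, hq⟩ then 1 else 0 := fun p => by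
    simp [unitMass, Subtype.ext_iff]
  simp [this]

theorem sum_shift {M : Type*} [AddCommMonoid M] (φ : ℤ × ℤ → M) (t : ℤ × ℤ)
    {S T : Finset (ℤ × ℤ)} (hS : ∀ p, φ p ≠ 0 → p ∈ S) (hT : ∀ p, φ (p + t) ≠ 0 → p ∈ T) :
    ∑ v ∈ T, φ (v + t) = ∑ p ∈ S, φ p := by
  rw [← finsum_eq_sum_of_support_subset φ (s := S) fun p hp => hS p hp,
    ← finsum_eq_sum_of_support_subset (fun v => φ (v + t)) (s := T) fun p hp => hT p hp]
  exact finsum_comp_equiv (Equiv.addRight t) (f := φ)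

theorem sum_flowDiv (ω : PixelFlow P) : ∑ p, flowDiv P ω p = 0 := by
  have hA : ∑ p ∈ P, zeroExt ω.1 (p + (-1, 0)) = ∑ p ∈ P, zeroExt ω.1 p := by
    refine sum_shift _ _ ?_ ?_ <;> rintro ⟨x, y⟩ hp <;> contrapose! hp <;>
      exact zeroExt_notMem _ (by simp [mem_hEdges, hp])
  have hB : ∑ p ∈ P, zeroExt ω.2 (p + (0, -1)) = ∑ p ∈ P, zeroExt ω.2 p := by
    refine sum_shift _ _ ?_ ?_ <;> rintro ⟨x, y⟩ hp <;> contrapose! hp <;>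
      exact zeroExt_notMem _ (by simp [mem_vEdges, hp])
  calc ∑ p, flowDiv P ω p
      = ∑ p ∈ P, (zeroExt ω.1 p - zeroExt ω.1 (p + (-1, 0)) + zeroExt ω.2 p
          - zeroExt ω.2 (p + (0, -1))) := by
        rw [← Finset.sum_coe_sort P]
        refine Finset.sum_congr rfl fun p _ => ?_
        simp only [flowDiv, gridDiv, LinearMap.pi_apply, LinearMap.coe_mk, AddHom.coe_mk,
          Prod.add_def, add_zero, ← sub_eq_add_neg]
    _ = 0 := by
        rw [Finset.sum_sub_distrib, Finset.sum_add_distrib, Finset.sum_sub_distrib, hA, hB]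
        ring

variable (P) in
/-- The sum of a function on `P`, as a linear form. -/
def sumForm : (P → ℚ) →ₗ[ℚ] ℚ := ∑ p, LinearMap.proj p

theorem sumForm_apply (f : P → ℚ) : sumForm P f = ∑ p, f p := by
  simp [sumForm]

theorem range_flowDiv (hne : P.Nonempty) (hconn : IsConn4 (P : Set (ℤ × ℤ))) :
    LinearMap.range (flowDiv P) = LinearMap.ker (sumForm P) := by
  refine le_antisymm ?_ fun f hf => ?_
  · rintro _ ⟨ω, rfl⟩
    rw [LinearMap.mem_ker, sumForm_apply, sum_flowDiv]
  obtain ⟨p₀, hp₀⟩ := hne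
  have hsum : ∑ p, f p = 0 := by rwa [LinearMap.mem_ker, sumForm_apply] at hf
  have key : f = ∑ p : P, f p • (unitMass P p - unitMass P p₀) := by
    ext q
    simp only [Finset.sum_apply, Pi.smul_apply, Pi.sub_apply, smul_eq_mul, mul_sub,
      Finset.sum_sub_distrib, ← Finset.sum_mul, hsum]
    simp [unitMass]
  rw [key]
  exact sum_mem fun p _ => Submodule.smul_mem _ _ (unitMass_sub_mem hconn p.2 hp₀)

theorem finrank_range_flowDiv (hne : P.Nonempty) (hconn : IsConn4 (P : Set (ℤ × ℤ))) :
    Module.finrank ℚ (LinearMap.range (flowDiv P)) + 1 = P.card := by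
  have hsurj : Function.Surjective (sumForm P) := by
    obtain ⟨p₀, hp₀⟩ := hne
    refine fun c => ⟨c • unitMass P p₀, ?_⟩
    rw [map_smul, sumForm_apply, sum_unitMass hp₀, smul_eq_mul, mul_one]
  have h := (sumForm P).finrank_range_add_finrank_ker
  rw [LinearMap.range_eq_top.2 hsurj, finrank_top, Module.finrank_self, Module.finrank_pi,
    Fintype.card_coe] at h
  rw [range_flowDiv hne hconn, ← h, add_comm]

/-- Euler's formula for the pixel adjacency graph. -/
theorem card_hEdges_add_card_vEdges [Finite (Face (P : Set (ℤ × ℤ)))] (hne : P.Nonempty)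
    (hconn : IsConn4 (P : Set (ℤ × ℤ))) :
    (hEdges P).card + (vEdges P).card + 2 = P.card + Nat.card (Face (P : Set (ℤ × ℤ))) := by
  have h1 := finrank_range_flowDiv hne hconn
  have h2 := finrank_ker_flowDiv (P := P)
  have h3 := (flowDiv P).finrank_range_add_finrank_ker
  rw [Module.finrank_prod, Module.finrank_pi, Module.finrank_pi, Fintype.card_coe,
    Fintype.card_coe] at h3
  omega

end Euler

section Counting

variable {P : Finset (ℤ × ℤ)}

/-- Lower left pixels of the full `2 × 2` blocks of `P`. -/
def fullBlocks (P : Finset (ℤ × ℤ)) : Finset (ℤ × ℤ) :=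
  P.filter fun p => (p.1 + 1, p.2) ∈ P ∧ (p.1, p.2 + 1) ∈ P ∧ (p.1 + 1, p.2 + 1) ∈ P

theorem mem_fullBlocks {x y : ℤ} : (x, y) ∈ fullBlocks P ↔
    (x, y) ∈ P ∧ (x + 1, y) ∈ P ∧ (x, y + 1) ∈ P ∧ (x + 1, y + 1) ∈ P := by
  simp [fullBlocks]

theorem cornerCount_eq (x y : ℤ) : cornerCount (P : Set (ℤ × ℤ)) x y =
    (if (x, y) ∈ P then 1 else 0) + (if (x + 1, y) ∈ P then 1 else 0) +
    (if (x, y + 1) ∈ P then 1 else 0) + (if (x + 1, y + 1) ∈ P then 1 else 0) := by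
  have h : (({(x, y), (x + 1, y), (x, y + 1), (x + 1, y + 1)} : Set (ℤ × ℤ)) ∩ P) =
      ((({(x, y), (x + 1, y), (x, y + 1), (x + 1, y + 1)} : Finset (ℤ × ℤ)).filter (· ∈ P) :
        Finset (ℤ × ℤ)) : Set (ℤ × ℤ)) := by
    ext p; simp
  rw [cornerCount, h, Set.ncard_coe_finset, Finset.card_filter, Finset.sum_insert (by simp),
    Finset.sum_insert (by simp), Finset.sum_insert (by simp), Finset.sum_singleton]
  ring

/-- Grid vertices on some pixel of `P`. -/
def cornerVertices (P : Finset (ℤ × ℤ)) : Finset (ℤ × ℤ) :=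
  (P ×ˢ ({(0, 0), (1, 0), (0, 1), (1, 1)} : Finset (ℤ × ℤ))).image fun q => q.1 - q.2

theorem mem_cornerVertices {x y : ℤ} : (x, y) ∈ cornerVertices P ↔
    (x, y) ∈ P ∨ (x + 1, y) ∈ P ∨ (x, y + 1) ∈ P ∨ (x + 1, y + 1) ∈ P := by
  simp only [cornerVertices, Finset.mem_image, Finset.mem_product, Finset.mem_insert,
    Finset.mem_singleton]
  constructor
  · rintro ⟨⟨⟨a, b⟩, t⟩, ⟨h, rfl | rfl | rfl | rfl⟩, ht⟩ <;>
      simp only [Prod.mk_sub_mk, Prod.mk.injEq] at ht <;> obtain ⟨rfl, rfl⟩ := ht <;> simp_all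
  · rintro (h | h | h | h)
    · exact ⟨⟨_, (0, 0)⟩, ⟨h, by simp⟩, by simp⟩
    · exact ⟨⟨_, (1, 0)⟩, ⟨h, by simp⟩, by simp⟩
    · exact ⟨⟨_, (0, 1)⟩, ⟨h, by simp⟩, by simp⟩
    · exact ⟨⟨_, (1, 1)⟩, ⟨h, by simp⟩, by simp⟩

theorem ncard_cornerCount_eq {n : ℕ} (hn : n ≠ 0) :
    {v : ℤ × ℤ | cornerCount (P : Set (ℤ × ℤ)) v.1 v.2 = n}.ncard =
    ∑ v ∈ cornerVertices P, if cornerCount (P : Set (ℤ × ℤ)) v.1 v.2 = n then 1 else 0 := by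
  rw [← Finset.card_filter, ← Set.ncard_coe_finset]
  congr 1
  ext ⟨x, y⟩
  simp only [Set.mem_ofPred_eq, Finset.coe_filter, iff_and_self, mem_cornerVertices]
  intro h
  by_contra! hc
  exact hn (by rw [← h, cornerCount_eq]; simp [hc])

theorem sum_cornerVertices_shift {S : Finset (ℤ × ℤ)} (hS : S ⊆ P) {t : ℤ × ℤ}
    (ht : t ∈ ({(0, 0), (1, 0), (0, 1), (1, 1)} : Finset (ℤ × ℤ))) :
    ∑ v ∈ cornerVertices P, (if v + t ∈ S then (1 : ℤ) else 0) = S.card := by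
  rw [sum_shift (fun p => if p ∈ S then (1 : ℤ) else 0) t (S := S)]
  · simp
  · intro p hp; by_contra h; simp [h] at hp
  · rintro ⟨x, y⟩ hp
    have h : (x, y) + t ∈ P := hS (by by_contra h; simp [h] at hp)
    rw [mem_cornerVertices]
    simp only [Finset.mem_insert, Finset.mem_singleton] at ht
    rcases ht with rfl | rfl | rfl | rfl <;> simp_all

/-- Bit-quad counting of the Euler characteristic. -/
theorem ncard_corners_sub (hP : NoPinch (P : Set (ℤ × ℤ))) :
    ({v : ℤ × ℤ | cornerCount (P : Set (ℤ × ℤ)) v.1 v.2 = 1}.ncard : ℤ) -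
      {v : ℤ × ℤ | cornerCount (P : Set (ℤ × ℤ)) v.1 v.2 = 3}.ncard =
    4 * P.card - 4 * ((hEdges P).card + (vEdges P).card) + 4 * (fullBlocks P).card := by
  have hE : hEdges P ⊆ P := Finset.filter_subset _ _
  have vE : vEdges P ⊆ P := Finset.filter_subset _ _
  have fB : fullBlocks P ⊆ P := Finset.filter_subset _ _
  have key : ∑ v ∈ cornerVertices P,
      ((if v + (0, 0) ∈ P then (1 : ℤ) else 0) + (if v + (1, 0) ∈ P then (1 : ℤ) else 0) +
        (if v + (0, 1) ∈ P then (1 : ℤ) else 0) + (if v + (1, 1) ∈ P then (1 : ℤ) else 0) -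
        2 * ((if v + (0, 0) ∈ hEdges P then (1 : ℤ) else 0) +
          (if v + (0, 1) ∈ hEdges P then (1 : ℤ) else 0) +
          (if v + (0, 0) ∈ vEdges P then (1 : ℤ) else 0) +
          (if v + (1, 0) ∈ vEdges P then (1 : ℤ) else 0)) +
        4 * (if v + (0, 0) ∈ fullBlocks P then (1 : ℤ) else 0)) =
      4 * P.card - 4 * ((hEdges P).card + (vEdges P).card) + 4 * (fullBlocks P).card := by
    simp only [Finset.sum_add_distrib, Finset.sum_sub_distrib, ← Finset.mul_sum]
    repeat rw [sum_cornerVertices_shift subset_rfl (by decide)]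
    repeat rw [sum_cornerVertices_shift hE (by decide)]
    repeat rw [sum_cornerVertices_shift vE (by decide)]
    rw [sum_cornerVertices_shift fB (by decide)]
    ring
  rw [← key, ncard_cornerCount_eq one_ne_zero, ncard_cornerCount_eq three_ne_zero]
  push_cast
  rw [← Finset.sum_sub_distrib]
  refine Finset.sum_congr rfl ?_
  rintro ⟨x, y⟩ -
  have hxy := hP x y
  simp only [cornerCount_eq, Prod.mk_add_mk, add_zero, mem_hEdges, mem_vEdges, mem_fullBlocks]
  simp only [Finset.mem_coe] at hxy
  by_cases h1 : (x, y) ∈ P <;> by_cases h2 : (x + 1, y) ∈ P <;>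
    by_cases h3 : (x, y + 1) ∈ P <;> by_cases h4 : (x + 1, y + 1) ∈ P <;> simp_all

end Counting

section Faces

theorem face_eq_of_notMem {P : Set (ℤ × ℤ)} {x y : ℤ} (h : (x, y) ∉ P) {a b : ℤ}
    (ha : a = x ∨ a = x - 1) (hb : b = y ∨ b = y - 1) : face P (a, b) = face P (x, y) := by
  have h1 : face P (x, y) = face P (x, y - 1) := face_up fun h' => h h'.1
  have h2 : face P (x, y) = face P (x - 1, y) := face_right fun h' => h h'.1
  have h3 : face P (x, y - 1) = face P (x - 1, y - 1) :=
    face_right fun h' => h (by simpa using h'.2)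
  rcases ha with rfl | rfl <;> rcases hb with rfl | rfl
  · rfl
  · exact h1.symm
  · exact h2.symm
  · exact (h1.trans h3).symm

/-- Two pixels outside `P` that are equal, 4-adjacent or diagonally adjacent lie in the same
face. -/
theorem face_eq_of_close {P : Set (ℤ × ℤ)} {x y a b : ℤ} (h : (x, y) ∉ P) (h' : (a, b) ∉ P)
    (hx : |x - a| ≤ 1) (hy : |y - b| ≤ 1) : face P (x, y) = face P (a, b) := by
  rw [abs_le] at hx hy
  rw [← face_eq_of_notMem h (a := min x a) (b := min y b) (by omega) (by omega),
    face_eq_of_notMem h' (by omega) (by omega)]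

theorem eq_of_face_eq {P : Finset (ℤ × ℤ)} {v w : ℤ × ℤ} (hv : v ∈ fullBlocks P)
    (h : face (P : Set (ℤ × ℤ)) v = face P w) : v = w := by
  obtain ⟨a, b⟩ := v
  rw [mem_fullBlocks] at hv
  have hresp : ∀ u u', VertexAdj (P : Set (ℤ × ℤ)) u u' → ((a, b) = u) = ((a, b) = u') := by
    rintro ⟨x, y⟩ u' (⟨rfl, hw⟩ | ⟨rfl, hw⟩)
    · have h1 : (a, b) ≠ (x, y) := by rintro ⟨⟩; exact hw ⟨hv.2.2.1, hv.2.2.2⟩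
      have h2 : (a, b) ≠ (x, y + 1) := by rintro ⟨⟩; exact hw ⟨hv.1, hv.2.1⟩
      exact propext ⟨fun h => absurd h h1, fun h => absurd h h2⟩
    · have h1 : (a, b) ≠ (x, y) := by rintro ⟨⟩; exact hw ⟨hv.2.1, hv.2.2.2⟩
      have h2 : (a, b) ≠ (x + 1, y) := by rintro ⟨⟩; exact hw ⟨hv.1, hv.2.2.1⟩
      exact propext ⟨fun h => absurd h h1, fun h => absurd h h2⟩
  exact (congrArg (Quot.lift (fun u => (a, b) = u) hresp) h).mp rfl

theorem exists_abs_le (P : Finset (ℤ × ℤ)) : ∃ M : ℤ, ∀ x y, (x, y) ∈ P → |x| ≤ M ∧ |y| ≤ M := by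
  obtain ⟨M, hM⟩ := (P.image fun p => max |p.1| |p.2|).exists_le
  exact ⟨M, fun x y h => max_le_iff.1 (hM _ (Finset.mem_image_of_mem _ h))⟩

theorem face_eq_outer {P : Set (ℤ × ℤ)} {M : ℤ} (hM : ∀ x y, (x, y) ∈ P → |x| ≤ M ∧ |y| ≤ M)
    {x y : ℤ} (h : M < |x| ∨ M < |y|) : face P (x, y) = face P (M + 1, M + 1) := by
  have row : ∀ y, M < |y| → ∀ x x', face P (x, y) = face P (x', y) := fun y hy =>
    int_const_of_step fun x => face_right fun h => hy.not_ge (hM _ _ h.1).2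
  have col : ∀ x, M < |x| → ∀ y y', face P (x, y) = face P (x, y') := fun x hx =>
    int_const_of_step fun y => face_up fun h => hx.not_ge (hM _ _ h.1).1
  have hM1 : M < |M + 1| := (lt_add_one M).trans_le (le_abs_self _)
  rcases h with h | h
  · rw [col x h y (M + 1), row _ hM1 x]
  · rw [row y h x (M + 1), col _ hM1 y]

instance (P : Finset (ℤ × ℤ)) : Finite (Face (P : Set (ℤ × ℤ))) := by
  obtain ⟨M, hM⟩ := exists_abs_le P
  refine Set.finite_univ_iff.1 (((insert (M + 1, M + 1)
    (Finset.Icc (-M) M ×ˢ Finset.Icc (-M) M)).finite_toSet.image (face P)).subset ?_)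
  intro c _
  obtain ⟨⟨x, y⟩, rfl⟩ := Quot.exists_rep c
  by_cases h : M < |x| ∨ M < |y|
  · exact ⟨(M + 1, M + 1), by simp, (face_eq_outer hM h).symm⟩
  · rw [not_or, not_lt, not_lt, abs_le, abs_le] at h
    exact ⟨(x, y), by simp [h], rfl⟩

theorem card_face (P : Finset (ℤ × ℤ)) : Nat.card (Face (P : Set (ℤ × ℤ))) =
    (fullBlocks P).card + (face P '' (P : Set (ℤ × ℤ))ᶜ).ncard := by
  have hdisj : Disjoint (face P '' (fullBlocks P : Set (ℤ × ℤ)))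
      (face P '' (P : Set (ℤ × ℤ))ᶜ) := by
    rw [Set.disjoint_left]
    rintro _ ⟨v, hv, rfl⟩ ⟨q, hq, h⟩
    exact hq (eq_of_face_eq hv h.symm ▸ Finset.filter_subset _ _ hv)
  rw [← Set.ncard_coe_finset, ← Set.InjOn.ncard_image (f := face P)
    fun v hv w _ h => eq_of_face_eq hv h, ← Set.ncard_union_eq hdisj, ← Set.ncard_univ]
  congr 1
  refine (Set.eq_univ_of_forall fun c => ?_).symm
  obtain ⟨⟨x, y⟩, rfl⟩ := Quot.exists_rep c
  by_cases hf : (x, y) ∈ fullBlocks P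
  · exact Or.inl ⟨_, hf, rfl⟩
  · right
    by_contra hc
    apply hf
    rw [mem_fullBlocks]
    refine ⟨?_, ?_, ?_, ?_⟩ <;> by_contra hp
    · exact hc ⟨_, hp, rfl⟩
    · exact hc ⟨_, hp, (face_eq_of_notMem hp (by simp) (by simp)).symm⟩
    · exact hc ⟨_, hp, (face_eq_of_notMem hp (by simp) (by simp)).symm⟩
    · exact hc ⟨_, hp, (face_eq_of_notMem hp (by simp) (by simp)).symm⟩

end Faces

section Topology

variable {P : Set (ℤ × ℤ)}

theorem mem_pixel {p : ℤ × ℤ} {x : ℝ × ℝ} :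
    x ∈ pixel p ↔ |x.1 - p.1| ≤ 1 / 2 ∧ |x.2 - p.2| ≤ 1 / 2 := by
  simp only [pixel, Set.mem_prod, Set.mem_Icc, abs_le]
  constructor <;> rintro ⟨⟨_, _⟩, _, _⟩ <;> refine ⟨⟨?_, ?_⟩, ?_, ?_⟩ <;> linarith

theorem mem_compl_pixelRegion {x : ℝ × ℝ} :
    x ∈ (pixelRegion P)ᶜ ↔ ∀ p, x ∈ pixel p → p ∉ P := by
  simp only [pixelRegion, Set.mem_compl_iff, Set.mem_iUnion, not_exists]
  exact forall_congr' fun p => forall_comm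

theorem mem_pixel_round (x : ℝ × ℝ) : x ∈ pixel (round x.1, round x.2) :=
  mem_pixel.2 ⟨abs_sub_round _, abs_sub_round _⟩

/-- The center of a pixel. -/
def center (p : ℤ × ℤ) : ℝ × ℝ := (p.1, p.2)

theorem center_mem_pixel (p : ℤ × ℤ) : center p ∈ pixel p := by
  simp [mem_pixel, center]

theorem eq_of_abs_sub {a b : ℤ} {t : ℝ} (ha : |t - a| < 1 / 2) (hb : |t - b| ≤ 1 / 2) : a = b := by
  rw [abs_lt] at ha
  rw [abs_le] at hb
  have h1 : (a : ℝ) < b + 1 := by linarith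
  have h2 : (b : ℝ) < a + 1 := by linarith
  norm_cast at h1 h2
  omega

theorem center_mem_compl {q : ℤ × ℤ} (hq : q ∉ P) : center q ∈ (pixelRegion P)ᶜ := by
  rw [mem_compl_pixelRegion]
  rintro p hp
  rw [mem_pixel] at hp
  rwa [← (Prod.ext (eq_of_abs_sub (by simp [center]) hp.1)
    (eq_of_abs_sub (by simp [center]) hp.2) : q = p)]

/-- The component of the complement of the pixel region containing the center of `q`. -/
def pixelComponent (P : Set (ℤ × ℤ)) (q : ℤ × ℤ) : Set (ℝ × ℝ) :=
  connectedComponentIn (pixelRegion P)ᶜ (center q)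

theorem pixelComponent_eq {q : ℤ × ℤ} {x : ℝ × ℝ} (hq : x ∈ pixel q)
    (hx : x ∈ (pixelRegion P)ᶜ) :
    pixelComponent P q = connectedComponentIn (pixelRegion P)ᶜ x := by
  have hqP : q ∉ P := mem_compl_pixelRegion.1 hx q hq
  have hseg : segment ℝ (center q) x ⊆ (pixelRegion P)ᶜ := by
    rintro z ⟨s, t, hs, ht, hst, rfl⟩
    rcases hs.eq_or_lt with rfl | hs
    · obtain rfl : t = 1 := by linarith
      simpa using hx
    have hlt : ∀ u c : ℝ, |u - c| ≤ 1 / 2 → |s * c + t * u - c| < 1 / 2 := fun u c h => by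
      obtain rfl : s = 1 - t := by linarith
      rw [show (1 - t) * c + t * u - c = t * (u - c) by ring, abs_mul, abs_of_nonneg ht]
      nlinarith [abs_nonneg (u - c)]
    rw [mem_pixel] at hq
    rw [mem_compl_pixelRegion]
    intro p hp
    rw [mem_pixel] at hp
    rwa [← (Prod.ext (eq_of_abs_sub (hlt _ _ hq.1) hp.1)
      (eq_of_abs_sub (hlt _ _ hq.2) hp.2) : q = p)]
  exact connectedComponentIn_eq ((convex_segment _ _).isPreconnected.subset_connectedComponentIn
    (left_mem_segment ℝ _ _) hseg (right_mem_segment ℝ _ _))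

theorem pixelComponent_eq_right {x y : ℤ} (h : (x, y) ∉ P) (h' : (x + 1, y) ∉ P) :
    pixelComponent P (x, y) = pixelComponent P (x + 1, y) := by
  have hx : ((x : ℝ) + 1 / 2, (y : ℝ)) ∈ (pixelRegion P)ᶜ := by
    rw [mem_compl_pixelRegion]
    rintro ⟨a, b⟩ hp
    rw [mem_pixel] at hp
    obtain rfl : y = b := eq_of_abs_sub (by simp) hp.2
    have h1 := abs_le.1 hp.1
    have h2 : (a : ℝ) < (x + 2 : ℤ) := by push_cast; linarith
    have h3 : ((x - 1 : ℤ) : ℝ) < a := by push_cast; linarith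
    norm_cast at h2 h3
    obtain rfl | rfl : a = x ∨ a = x + 1 := by omega
    · exact h
    · exact h'
  rw [pixelComponent_eq _ hx, pixelComponent_eq _ hx] <;>
    rw [mem_pixel] <;> norm_num [abs_le]

theorem pixelComponent_eq_up {x y : ℤ} (h : (x, y) ∉ P) (h' : (x, y + 1) ∉ P) :
    pixelComponent P (x, y) = pixelComponent P (x, y + 1) := by
  have hx : ((x : ℝ), (y : ℝ) + 1 / 2) ∈ (pixelRegion P)ᶜ := by
    rw [mem_compl_pixelRegion]
    rintro ⟨a, b⟩ hp
    rw [mem_pixel] at hp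
    obtain rfl : x = a := eq_of_abs_sub (by simp) hp.1
    have h1 := abs_le.1 hp.2
    have h2 : (b : ℝ) < (y + 2 : ℤ) := by push_cast; linarith
    have h3 : ((y - 1 : ℤ) : ℝ) < b := by push_cast; linarith
    norm_cast at h2 h3
    obtain rfl | rfl : b = y ∨ b = y + 1 := by omega
    · exact h
    · exact h'
  rw [pixelComponent_eq _ hx, pixelComponent_eq _ hx] <;>
    rw [mem_pixel] <;> norm_num [abs_le]

/-- The four pixels around the grid vertex `v`. -/
def block (v : ℤ × ℤ) : Set (ℤ × ℤ) :=
  {(v.1, v.2), (v.1 + 1, v.2), (v.1, v.2 + 1), (v.1 + 1, v.2 + 1)}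

theorem pixelComponent_eq_of_mem_block (hP : NoPinch P) {v p q : ℤ × ℤ} (hpv : p ∈ block v)
    (hqv : q ∈ block v) (hp : p ∉ P) (hq : q ∉ P) :
    pixelComponent P p = pixelComponent P q := by
  obtain ⟨x, y⟩ := v
  have hxy := hP x y
  have h1 := @pixelComponent_eq_right P x y
  have h2 := @pixelComponent_eq_right P x (y + 1)
  have h3 := @pixelComponent_eq_up P x y
  have h4 := @pixelComponent_eq_up P (x + 1) y
  simp only [block, Set.mem_insert_iff, Set.mem_singleton_iff] at hpv hqv
  rcases hpv with rfl | rfl | rfl | rfl <;> rcases hqv with rfl | rfl | rfl | rfl <;> grind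

theorem pixelComponent_eq_of_face_eq (hP : NoPinch P) {p q : ℤ × ℤ} (hp : p ∉ P) (hq : q ∉ P)
    (h : face P p = face P q) : pixelComponent P p = pixelComponent P q := by
  have hunion : ∀ {v r}, r ∈ block v → r ∉ P →
      ⋃ s ∈ block v \ P, pixelComponent P s = pixelComponent P r := fun hr hrP =>
    Set.Subset.antisymm
      (Set.iUnion₂_subset fun s hs =>
        (pixelComponent_eq_of_mem_block hP hs.1 hr hs.2 hrP).subset)
      (Set.subset_biUnion_of_mem (u := pixelComponent P) ⟨hr, hrP⟩)
  have hresp : ∀ u w, VertexAdj P u w → ⋃ s ∈ block u \ P, pixelComponent P s =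
      ⋃ s ∈ block w \ P, pixelComponent P s := by
    have key : ∀ {u w r s}, r ∈ block u → r ∈ block w → s ∈ block u → s ∈ block w →
        ¬(r ∈ P ∧ s ∈ P) → ⋃ s ∈ block u \ P, pixelComponent P s =
          ⋃ s ∈ block w \ P, pixelComponent P s := by
      intro u w r s h1 h2 h3 h4 h5
      rcases not_and_or.1 h5 with h | h
      · rw [hunion h1 h, hunion h2 h]
      · rw [hunion h3 h, hunion h4 h]
    rintro u w (⟨rfl, hw⟩ | ⟨rfl, hw⟩) <;>
      exact key (by simp [block]) (by simp [block]) (by simp [block]) (by simp [block]) hw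
  have := congrArg (Quot.lift (fun v => ⋃ s ∈ block v \ P, pixelComponent P s) hresp) h
  rwa [← hunion (v := p) (by simp [block]) hp, ← hunion (v := q) (by simp [block]) hq]

theorem locallyFinite_pixel : LocallyFinite pixel := by
  intro x
  refine ⟨Metric.ball x 1, Metric.ball_mem_nhds x one_pos,
    (Set.finite_Icc (⌊x.1⌋ - 2, ⌊x.2⌋ - 2) (⌊x.1⌋ + 3, ⌊x.2⌋ + 3)).subset ?_⟩
  rintro ⟨a, b⟩ ⟨z, hz, hzx⟩
  rw [mem_pixel, abs_le, abs_le] at hz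
  rw [Metric.mem_ball, Prod.dist_eq, max_lt_iff, Real.dist_eq, Real.dist_eq, abs_lt, abs_lt] at hzx
  have f1 := Int.floor_le x.1
  have f2 := Int.lt_floor_add_one x.1
  have f3 := Int.floor_le x.2
  have f4 := Int.lt_floor_add_one x.2
  refine ⟨⟨?_, ?_⟩, ⟨?_, ?_⟩⟩ <;> rify <;> linarith [hz.1.1, hz.1.2, hz.2.1, hz.2.2]

theorem isClosed_biUnion_pixel (S : Set (ℤ × ℤ)) : IsClosed (⋃ p ∈ S, pixel p) := by
  rw [Set.biUnion_eq_iUnion]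
  exact (locallyFinite_pixel.comp_injective Subtype.val_injective).isClosed_iUnion
    fun p => isClosed_Icc.prod isClosed_Icc

theorem face_eq_of_mem_pixel {p q : ℤ × ℤ} {x : ℝ × ℝ} (hp : x ∈ pixel p) (hq : x ∈ pixel q)
    (hpP : p ∉ P) (hqP : q ∉ P) : face P p = face P q := by
  have key : ∀ {t : ℝ} {a b : ℤ}, |t - a| ≤ 1 / 2 → |t - b| ≤ 1 / 2 → |a - b| ≤ 1 := by
    intro t a b h h'
    rw [abs_le] at h h' ⊢
    constructor <;> rify <;> linarith
  rw [mem_pixel] at hp hq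
  exact face_eq_of_close hpP hqP (key hp.1 hq.1) (key hp.2 hq.2)

theorem face_eq_of_pixelComponent_eq {p q : ℤ × ℤ} (hp : p ∉ P) (hq : q ∉ P)
    (h : pixelComponent P p = pixelComponent P q) : face P p = face P q := by
  by_contra hne
  have hsub : pixelComponent P p ⊆ (pixelRegion P)ᶜ := connectedComponentIn_subset _ _
  have hpre : IsPreconnected (pixelComponent P p) := isPreconnected_connectedComponentIn
  obtain ⟨x, -, hA, hB⟩ := isPreconnected_closed_iff.1 hpre _ _
    (isClosed_biUnion_pixel {r | r ∉ P ∧ face P r = face P p})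
    (isClosed_biUnion_pixel {r | r ∉ P ∧ face P r ≠ face P p})
    (fun x hx => by
      have hr := mem_compl_pixelRegion.1 (hsub hx) _ (mem_pixel_round x)
      by_cases hf : face P (round x.1, round x.2) = face P p
      · exact Or.inl (Set.mem_biUnion ⟨hr, hf⟩ (mem_pixel_round x))
      · exact Or.inr (Set.mem_biUnion ⟨hr, hf⟩ (mem_pixel_round x)))
    ⟨center p, mem_connectedComponentIn (center_mem_compl hp),
      Set.mem_biUnion ⟨hp, rfl⟩ (center_mem_pixel p)⟩
    ⟨center q, h ▸ mem_connectedComponentIn (center_mem_compl hq),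
      Set.mem_biUnion ⟨hq, Ne.symm hne⟩ (center_mem_pixel q)⟩
  simp only [Set.mem_iUnion, exists_prop] at hA hB
  obtain ⟨a, ⟨ha, hap⟩, hxa⟩ := hA
  obtain ⟨b, ⟨hb, hbp⟩, hxb⟩ := hB
  exact hbp ((face_eq_of_mem_pixel hxb hxa hb ha).trans hap)

theorem ncard_image_eq_of_iff {α β γ : Type*} {s : Set α} {f : α → β} {g : α → γ}
    (h : ∀ a ∈ s, ∀ b ∈ s, f a = f b ↔ g a = g b) : (f '' s).ncard = (g '' s).ncard := by
  refine Set.ncard_congr (fun b hb => g hb.choose)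
    (fun b hb => ⟨_, hb.choose_spec.1, rfl⟩) (fun b c hb hc hbc => ?_) ?_
  · rw [← hb.choose_spec.2, ← hc.choose_spec.2]
    exact (h _ hb.choose_spec.1 _ hc.choose_spec.1).2 hbc
  · rintro _ ⟨a, ha, rfl⟩
    have hfa : f a ∈ f '' s := ⟨a, ha, rfl⟩
    exact ⟨f a, hfa, (h _ hfa.choose_spec.1 _ ha).1 hfa.choose_spec.2⟩

/-- Exactly one component of the complement of the pixel region is unbounded. -/
theorem ncard_holes_add_one {P : Finset (ℤ × ℤ)} (hP : NoPinch (P : Set (ℤ × ℤ))) :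
    {D : Set (ℝ × ℝ) | (∃ x ∈ (pixelRegion (P : Set (ℤ × ℤ)))ᶜ,
      D = connectedComponentIn (pixelRegion (P : Set (ℤ × ℤ)))ᶜ x) ∧
      Bornology.IsBounded D}.ncard + 1 = (face P '' (P : Set (ℤ × ℤ))ᶜ).ncard := by
  obtain ⟨M, hM⟩ := exists_abs_le P
  have hout : ∀ {x y : ℤ}, M < |x| ∨ M < |y| → (x, y) ∉ (P : Set (ℤ × ℤ)) := fun h h' =>
    h.elim (fun h => h.not_ge (hM _ _ h').1) fun h => h.not_ge (hM _ _ h').2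
  have hM1 : M < |M + 1| := (lt_add_one M).trans_le (le_abs_self _)
  have hcomp : ∀ {x y : ℤ}, M < |x| ∨ M < |y| →
      pixelComponent P (x, y) = pixelComponent P (M + 1, M + 1) := fun h =>
    pixelComponent_eq_of_face_eq hP (hout h) (hout (Or.inl hM1)) (face_eq_outer hM h)
  have hunb : ¬ Bornology.IsBounded (pixelComponent P (M + 1, M + 1)) := by
    intro hb
    obtain ⟨C, hC⟩ := hb.exists_norm_le
    have hmem : center (⌈C⌉ + 1, M + 1) ∈ pixelComponent P (M + 1, M + 1) := by
      rw [← hcomp (x := ⌈C⌉ + 1) (Or.inr hM1)]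
      exact mem_connectedComponentIn (center_mem_compl (hout (Or.inr hM1)))
    have h1 := (norm_fst_le _).trans (hC _ hmem)
    have h2 := (le_abs_self _).trans h1
    simp only [center] at h2
    push_cast at h2
    linarith [Int.le_ceil C]
  have hset : {D : Set (ℝ × ℝ) | (∃ x ∈ (pixelRegion (P : Set (ℤ × ℤ)))ᶜ,
      D = connectedComponentIn (pixelRegion (P : Set (ℤ × ℤ)))ᶜ x) ∧ Bornology.IsBounded D} =
      (pixelComponent P '' (P : Set (ℤ × ℤ))ᶜ) \ {pixelComponent P (M + 1, M + 1)} := by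
    ext D
    constructor
    · rintro ⟨⟨x, hx, rfl⟩, hb⟩
      refine ⟨⟨_, mem_compl_pixelRegion.1 hx _ (mem_pixel_round x),
        pixelComponent_eq (mem_pixel_round x) hx⟩, fun h => hunb ?_⟩
      rwa [← Set.mem_singleton_iff.1 h]
    · rintro ⟨⟨q, hq, rfl⟩, hne⟩
      refine ⟨⟨center q, center_mem_compl hq, rfl⟩,
        (Metric.isBounded_Icc ((-(M + 1), -(M + 1)) : ℝ × ℝ) (M + 1, M + 1)).subset ?_⟩
      intro x hx
      have hxc := connectedComponentIn_subset _ _ hx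
      have hround := mem_pixel_round x
      have heq : pixelComponent P q = pixelComponent P (round x.1, round x.2) :=
        (connectedComponentIn_eq hx).trans (pixelComponent_eq hround hxc).symm
      have hin : ¬(M < |round x.1| ∨ M < |round x.2|) := fun h => hne (heq.trans (hcomp h))
      rw [not_or, not_lt, not_lt, abs_le, abs_le] at hin
      rify at hin
      rw [mem_pixel, abs_le, abs_le] at hround
      obtain ⟨⟨_, _⟩, _, _⟩ := hround
      obtain ⟨⟨_, _⟩, _, _⟩ := hin
      refine ⟨⟨?_, ?_⟩, ?_, ?_⟩ <;> dsimp only at * <;> linarith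
  have hncard : (pixelComponent P '' (P : Set (ℤ × ℤ))ᶜ).ncard =
      (face P '' (P : Set (ℤ × ℤ))ᶜ).ncard := ncard_image_eq_of_iff fun a ha b hb =>
    ⟨face_eq_of_pixelComponent_eq ha hb, pixelComponent_eq_of_face_eq hP ha hb⟩
  have hmem : pixelComponent P (M + 1, M + 1) ∈ pixelComponent P '' (P : Set (ℤ × ℤ))ᶜ :=
    ⟨_, hout (Or.inl hM1), rfl⟩
  have hpos : (face P '' (P : Set (ℤ × ℤ))ᶜ).ncard ≠ 0 :=
    ((Set.ncard_pos (Set.toFinite _)).2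
      (Set.Nonempty.image _ ⟨(M + 1, M + 1), hout (Or.inl hM1)⟩)).ne'
  rw [hset, ← hncard, Set.ncard_sdiff_singleton_add_one hmem
    (Set.finite_of_ncard_ne_zero (hncard ▸ hpos))]

end Topology

/-- **Digital hole-counting formula.**
For a finite nonempty 4-connected set of pixels `P` without pinch points, the number
`h` of bounded connected components of the complement of the pixel region (the number
of holes) satisfies `h = 1 + (In_p − Out_p)/4`, where `Out_p` (resp. `In_p`) is the
number of grid vertices met by exactly one (resp. exactly three) squares of `P`. -/
theorem hole_counting (P : Set (ℤ × ℤ)) (hfin : P.Finite) (hne : P.Nonempty)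
    (hconn : IsConn4 P) (hpinch : NoPinch P)
    (Outp Inp h : ℕ)
    (hOut : Outp = {v : ℤ × ℤ | cornerCount P v.1 v.2 = 1}.ncard)
    (hIn : Inp = {v : ℤ × ℤ | cornerCount P v.1 v.2 = 3}.ncard)
    (hh : h = {D : Set (ℝ × ℝ) |
            (∃ x ∈ (pixelRegion P)ᶜ, D = connectedComponentIn (pixelRegion P)ᶜ x) ∧
            Bornology.IsBounded D}.ncard) :
    (h : ℚ) = 1 + ((Inp : ℚ) - (Outp : ℚ)) / 4 := by
  lift P to Finset (ℤ × ℤ) using hfin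
  have h1 := card_hEdges_add_card_vEdges (Finset.coe_nonempty.1 hne) hconn
  have h2 := ncard_corners_sub hpinch
  have h3 := ncard_holes_add_one hpinch
  have h4 := card_face P
  rw [← hOut, ← hIn] at h2
  rw [← hh] at h3
  qify at h1 h2 h3 h4
  linarith
end

section
/- Let d ≥ 1 and let S ⊆ ℤ^d be nonempty. Define the squared Euclidean distance transform D : ℤ^d → ℝ≥0∞ by D(x) = inf_{y ∈ S} Σ_{i=1}^d (x_i − y_i)². For each axis i ∈ {1, …, d}, define the one-dimensional lower-envelope operator T_i acting on functions f : ℤ^d → ℝ≥0∞ by (T_i f)(x) = inf_{t ∈ ℤ} ( f(x₁, …, x_{i−1}, t, x_{i+1}, …, x_d) + (x_i − t)² ). Let f₀ : ℤ^d → ℝ≥0∞ be 0 on S and ∞ elsewhere. Then D = T_d ∘ T_{d−1} ∘ ⋯ ∘ T_1 (f₀); i.e., the squared Euclidean distance transform is computed exactly by d successive one-dimensional operations, one per coordinate axis (correctness of the separable error-free Euclidean distance transform). -/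
open scoped ENNReal

/-- Composing one-dimensional infimal convolutions along distinct axes yields the joint infimal
convolution over all of these axes. -/
theorem foldl_iInf_update_add {ι α : Type*} [DecidableEq ι] (c : ι → α → α → ℝ≥0∞)
    (T : ι → ((ι → α) → ℝ≥0∞) → ((ι → α) → ℝ≥0∞))
    (hT : ∀ i f x, T i f x = ⨅ t : α, (f (Function.update x i t) + c i (x i) t))
    (f : (ι → α) → ℝ≥0∞) (l : List ι) (hl : l.Nodup) (x : ι → α) :
    List.foldl (fun g i => T i g) f l x =
      ⨅ y : ι → α, (f (fun j => if j ∈ l then y j else x j) +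
        (l.map fun j => c j (x j) (y j)).sum) := by
  induction l using List.reverseRecOn generalizing x with
  | nil =>
    have : Nonempty (ι → α) := ⟨x⟩
    simp
  | append_singleton l i ih =>
    have hi : i ∉ l := fun h => (List.nodup_append.1 hl).2.2 i h i (List.mem_singleton_self i) rfl
    have hl' : l.Nodup := hl.of_append_left
    have hsum (t : α) (y : ι → α) : (l.map fun j => c j (Function.update x i t j) (y j)) =
        l.map fun j => c j (x j) (y j) :=
      List.map_congr_left fun j hj => by
        rw [Function.update_of_ne (ne_of_mem_of_not_mem hj hi)]
    simp only [List.foldl_append, List.foldl_cons, List.foldl_nil, hT, ih hl', hsum,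
      ENNReal.iInf_add, List.map_append, List.map_cons, List.map_nil, List.sum_append,
      List.sum_singleton, List.mem_append, List.mem_singleton]
    apply le_antisymm
    · refine le_iInf fun y => (iInf₂_le (y i) y).trans_eq ?_
      rw [add_assoc]
      congr 2
      funext j
      by_cases hj : j = i
      · subst hj; simp [hi]
      · simp [hj]
    · refine le_iInf₂ fun t y => (iInf_le _ (Function.update y i t)).trans_eq ?_
      have hsum' : (l.map fun j => c j (x j) (Function.update y i t j)) =
          l.map fun j => c j (x j) (y j) :=
        List.map_congr_left fun j hj => by
          rw [Function.update_of_ne (ne_of_mem_of_not_mem hj hi)]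
      rw [hsum', Function.update_self, add_assoc]
      congr 2
      funext j
      by_cases hj : j = i
      · subst hj; simp [hi]
      · simp [hj]

/-- **Correctness of the separable error-free squared Euclidean distance transform.**
For a nonempty `S ⊆ ℤ^d`, the squared Euclidean distance transform
`D x = inf_{y ∈ S} Σᵢ (xᵢ − yᵢ)²` is obtained from the indicator-type function `f₀`
(zero on `S`, infinite elsewhere) by applying, once per coordinate axis, the
one-dimensional lower-envelope operator
`(Tᵢ f) x = inf_{t ∈ ℤ} ( f (x with i-th coordinate t) + (xᵢ − t)² )`. -/
theorem separable_edt_correct (d : ℕ) (hd : 1 ≤ d) (S : Set (Fin d → ℤ)) (hS : S.Nonempty)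
    (D : (Fin d → ℤ) → ℝ≥0∞)
    (hD : ∀ x, D x = ⨅ y ∈ S, ∑ i, ((x i - y i).natAbs ^ 2 : ℝ≥0∞))
    (T : Fin d → ((Fin d → ℤ) → ℝ≥0∞) → ((Fin d → ℤ) → ℝ≥0∞))
    (hT : ∀ i f x,
      T i f x = ⨅ t : ℤ, (f (Function.update x i t) + ((x i - t).natAbs ^ 2 : ℝ≥0∞)))
    (f₀ : (Fin d → ℤ) → ℝ≥0∞)
    (hf₀ : ∀ x, f₀ x = ⨅ (_ : x ∈ S), (0 : ℝ≥0∞)) :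
    D = List.foldl (fun f i => T i f) f₀ (List.finRange d) := by
  funext x
  rw [foldl_iInf_update_add (fun _ s t => ((s - t).natAbs ^ 2 : ℝ≥0∞)) T hT f₀ _
    (List.nodup_finRange d), hD]
  refine iInf_congr fun y => ?_
  by_cases hy : y ∈ S <;> simp [hf₀, hy, Fin.sum_univ_def]
end
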